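/- Let w = w_t be the work function at time t ≥ 1 of a 3-server instance on the circle of circumference 2Δ with last request r = r_t, let u be a circle point, and let (x,y,z) ∈ P. Suppose both w({u,x,ȳ}) and w({u,z,x̄}) resolve from u, w({u,y,z̄}) resolves from y, and r lies on the arc between ȳ and z̄ not containing x̄ (i.e., d(ȳ,r) + d(r,z̄) = d(ȳ,z̄)). Then there exists a triple (x',y',z') ∈ P such that Φ*(w, u, x, y, z) ≥ Φ*(w, r, x', y', z'). -/

import Mathlib

open Finset

/-- Minimum-matching (Wasserstein) distance between two `k`-point configurations,
represented as `k`-tuples of points. -/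
noncomputable def confDist {Ω : Type*} [MetricSpace Ω] {k : ℕ} (X Y : Fin k → Ω) : ℝ :=
  ⨅ σ : Equiv.Perm (Fin k), ∑ i, dist (X i) (Y (σ i))

/-- The work function at time `t` of the `k`-server instance with initial configuration
`X₀` and requests `r 1, r 2, …` (the value `r 0` is unused): the least cost of serving
the first `t` requests and then moving to the configuration `X`. -/
noncomputable def workFn {Ω : Type*} [MetricSpace Ω] (k : ℕ) (X₀ : Fin k → Ω)
    (r : ℕ → Ω) (t : ℕ) (X : Fin k → Ω) : ℝ :=
  sInf { c : ℝ | ∃ Y : ℕ → Fin k → Ω, Y 0 = X₀ ∧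
    (∀ i ∈ Finset.Icc 1 t, ∃ j, Y i j = r i) ∧
    c = (∑ i ∈ Finset.Icc 1 t, confDist (Y (i - 1)) (Y i)) + confDist (Y t) X }

/-- The offline optimum of the `k`-server instance with initial configuration `X₀`
and requests `r 1, …, r T`. -/
noncomputable def opt {Ω : Type*} [MetricSpace Ω] (k : ℕ) (X₀ : Fin k → Ω)
    (r : ℕ → Ω) (T : ℕ) : ℝ :=
  sInf { c : ℝ | ∃ Y : ℕ → Fin k → Ω, Y 0 = X₀ ∧
    (∀ i ∈ Finset.Icc 1 T, ∃ j, Y i j = r i) ∧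
    c = ∑ i ∈ Finset.Icc 1 T, confDist (Y (i - 1)) (Y i) }

/-- `OPT_t(Z)`: the least cost of serving the first `t` requests while ending
in the configuration `Z`. -/
noncomputable def optTo {Ω : Type*} [MetricSpace Ω] (k : ℕ) (X₀ : Fin k → Ω)
    (r : ℕ → Ω) (t : ℕ) (Z : Fin k → Ω) : ℝ :=
  sInf { c : ℝ | ∃ Y : ℕ → Fin k → Ω, Y 0 = X₀ ∧
    (∀ i ∈ Finset.Icc 1 t, ∃ j, Y i j = r i) ∧ Y t = Z ∧
    c = ∑ i ∈ Finset.Icc 1 t, confDist (Y (i - 1)) (Y i) }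

/-- `X 0, X 1, …, X T` is a run of the work function algorithm on the `k`-server
instance with initial configuration `X₀` and requests `r 1, …, r T`. -/
def IsWFARun {Ω : Type*} [MetricSpace Ω] (k : ℕ) (X₀ : Fin k → Ω)
    (r : ℕ → Ω) (T : ℕ) (X : ℕ → Fin k → Ω) : Prop :=
  X 0 = X₀ ∧ ∀ t, 1 ≤ t → t ≤ T →
    (∃ j, X t j = r t) ∧
    ∀ Z : Fin k → Ω, (∃ j, Z j = r t) →
      optTo k X₀ r t (X t) + confDist (X t) (X (t - 1)) ≤
        optTo k X₀ r t Z + confDist Z (X (t - 1))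
/-- The antipode `x̄ = x + Δ` of a point on the circle of circumference `2Δ`. -/
noncomputable def antip (Δ : ℝ) (x : AddCircle (2*Δ)) : AddCircle (2*Δ) := x + (Δ : ℝ)

/-- The set `P`: triples of circle points not contained in any open semicircle,
i.e. with `d(x,y) + d(y,z) + d(z,x) = 2Δ`. -/
def InP (Δ : ℝ) (x y z : AddCircle (2*Δ)) : Prop :=
  dist x y + dist y z + dist z x = 2*Δ

/-- The potential `Φ*(w,u,x,y,z) = w(ū³) + w(u x ȳ) + w(u y z̄) + w(u z x̄)`. -/
noncomputable def PhiStar (Δ : ℝ) (w : (Fin 3 → AddCircle (2*Δ)) → ℝ)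
    (u x y z : AddCircle (2*Δ)) : ℝ :=
  w ![antip Δ u, antip Δ u, antip Δ u] + w ![u, x, antip Δ y]
    + w ![u, y, antip Δ z] + w ![u, z, antip Δ x]

/-- `w(X)` resolves from the `i`-th point of the configuration `X` (w.r.t. the
last request `r`): `w(X) = w(X - X i + r) + d(X i, r)`. -/
def ResolvesFrom {Ω : Type*} [MetricSpace Ω] (w : (Fin 3 → Ω) → ℝ) (r : Ω)
    (X : Fin 3 → Ω) (i : Fin 3) : Prop :=
  w X = w (Function.update X i r) + dist (X i) r

section WorkFunction

variable {Ω : Type*} [MetricSpace Ω] {k : ℕ}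

lemma confDist_le_sum (X Y : Fin k → Ω) (σ : Equiv.Perm (Fin k)) :
    confDist X Y ≤ ∑ i, dist (X i) (Y (σ i)) :=
  ciInf_le (Set.finite_range _).bddBelow σ

lemma exists_confDist_eq_sum (X Y : Fin k → Ω) :
    ∃ σ : Equiv.Perm (Fin k), confDist X Y = ∑ i, dist (X i) (Y (σ i)) := by
  obtain ⟨σ, hσ⟩ := exists_eq_ciInf_of_finite
    (f := fun σ : Equiv.Perm (Fin k) => ∑ i, dist (X i) (Y (σ i)))
  exact ⟨σ, hσ.symm⟩

lemma confDist_nonneg (X Y : Fin k → Ω) : 0 ≤ confDist X Y :=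
  Real.iInf_nonneg fun _ => Finset.sum_nonneg fun _ _ => dist_nonneg

lemma confDist_comp_perm (X Y : Fin k → Ω) (σ : Equiv.Perm (Fin k)) :
    confDist X (Y ∘ σ) = confDist X Y :=
  (Equiv.mulLeft σ).iInf_congr fun _ => rfl

lemma confDist_le_add_sum (X Y Z : Fin k → Ω) :
    confDist X Y ≤ confDist X Z + ∑ i, dist (Z i) (Y i) := by
  obtain ⟨σ, hσ⟩ := exists_confDist_eq_sum X Z
  rw [hσ, ← Equiv.sum_comp σ (fun i => dist (Z i) (Y i)), ← Finset.sum_add_distrib]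
  exact (confDist_le_sum X Y σ).trans (Finset.sum_le_sum fun i _ => dist_triangle _ _ _)

lemma sum_dist_update_le (Z Y : Fin k → Ω) (m : Fin k) (p : Ω) (hZ : Z m = p) :
    ∑ i, dist (Z i) (Function.update Y m p i) + dist (Y m) p ≤ ∑ i, dist (Z i) (Y i) := by
  rw [← Finset.add_sum_erase _ _ (Finset.mem_univ m),
    ← Finset.add_sum_erase _ (fun i => dist (Z i) (Y i)) (Finset.mem_univ m)]
  have : ∑ i ∈ Finset.univ.erase m, dist (Z i) (Function.update Y m p i) =
      ∑ i ∈ Finset.univ.erase m, dist (Z i) (Y i) :=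
    Finset.sum_congr rfl fun i hi => by
      rw [Function.update_of_ne (Finset.ne_of_mem_erase hi)]
  simp [this, hZ, dist_comm p, add_comm]

lemma sum_dist_update_self (X : Fin k → Ω) (j : Fin k) (p : Ω) :
    ∑ i, dist (Function.update X j p i) (X i) = dist (X j) p := by
  rw [Finset.sum_eq_single j]
  · simp [dist_comm]
  · intro i _ hi
    simp [hi]
  · simp

/-- Invariance under relabelling, 1-Lipschitz continuity and quasi-convexity: the properties
shared by all work functions. -/
structure IsQuasiconvexCost (w : (Fin k → Ω) → ℝ) : Prop where
  comp_perm : ∀ X (σ : Equiv.Perm (Fin k)), w (X ∘ σ) = w X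
  le_add_sum : ∀ X Z, w X ≤ w Z + ∑ i, dist (Z i) (X i)
  exchange : ∀ X Y, ∃ σ : Equiv.Perm (Fin k), ∀ s : Fin k → Bool,
    w (fun i => if s i then X i else Y (σ i)) + w (fun i => if s i then Y (σ i) else X i)
      ≤ w X + w Y

/-- The exchange bijection may be chosen to match a common point of both configurations. -/
lemma IsQuasiconvexCost.exchange_of_eq {w : (Fin k → Ω) → ℝ} (hw : IsQuasiconvexCost w)
    (X Y : Fin k → Ω) (a b : Fin k) (hab : X a = Y b) :
    ∃ σ : Equiv.Perm (Fin k), σ a = b ∧ ∀ s : Fin k → Bool,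
      w (fun i => if s i then X i else Y (σ i)) + w (fun i => if s i then Y (σ i) else X i)
        ≤ w X + w Y := by
  obtain ⟨σ, hσ⟩ := hw.exchange X Y
  refine ⟨σ.trans (Equiv.swap (σ a) b), by simp, fun s => ?_⟩
  set c := σ.symm b with hc
  have hcb : σ c = b := by simp [hc]
  have key := hσ (Function.update s a (s c))
  have hval : ∀ i, i ≠ a → i ≠ c → Equiv.swap (σ a) b (σ i) = σ i := fun i h1 h2 =>
    Equiv.swap_apply_of_ne_of_ne (fun h => h1 (σ.injective h))
      (fun h => h2 (σ.injective (h.trans hcb.symm)))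
  have hvc : Equiv.swap (σ a) b (σ c) = σ a := by rw [hcb]; simp
  by_cases hac : a = c
  · have hs : Function.update s a (s c) = s := by rw [← hac]; simp
    have hid : Equiv.swap (σ a) b = Equiv.refl _ := by rw [hac, hcb]; simp
    rw [hs] at key
    simpa [hid] using key
  by_cases hs : s c = true
  · have e1 : (fun i => if s i then X i else Y ((σ.trans (Equiv.swap (σ a) b)) i)) =
        fun i => if Function.update s a (s c) i then X i else Y (σ i) := by
      funext i
      by_cases h1 : i = a
      · subst h1; simp [hs, hab]
      by_cases h2 : i = c
      · subst h2; simp [hs, h1]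
      simp [h1, hval i h1 h2]
    have e2 : (fun i => if s i then Y ((σ.trans (Equiv.swap (σ a) b)) i) else X i) =
        (fun i => if Function.update s a (s c) i then Y (σ i) else X i) ∘ Equiv.swap a c := by
      funext i
      by_cases h1 : i = a
      · subst h1; simp [hs, hab, Ne.symm hac, hcb]
      by_cases h2 : i = c
      · rw [h2]; simp [hs, hvc]
      simp [h1, hval i h1 h2, Equiv.swap_apply_of_ne_of_ne h1 h2]
    rw [e1, e2, hw.comp_perm]
    exact key
  · have e1 : (fun i => if s i then X i else Y ((σ.trans (Equiv.swap (σ a) b)) i)) =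
        (fun i => if Function.update s a (s c) i then X i else Y (σ i)) ∘ Equiv.swap a c := by
      funext i
      by_cases h1 : i = a
      · subst h1; simp [hs, hab, Ne.symm hac, hcb]
      by_cases h2 : i = c
      · rw [h2]; simp [hs, hvc]
      simp [h1, hval i h1 h2, Equiv.swap_apply_of_ne_of_ne h1 h2]
    have e2 : (fun i => if s i then Y ((σ.trans (Equiv.swap (σ a) b)) i) else X i) =
        fun i => if Function.update s a (s c) i then Y (σ i) else X i := by
      funext i
      by_cases h1 : i = a
      · subst h1; simp [hs, hab]
      by_cases h2 : i = c
      · subst h2; simp [hs, h1]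
      simp [h1, hval i h1 h2]
    rw [e1, e2, hw.comp_perm]
    exact key

variable (X₀ : Fin k → Ω) (r : ℕ → Ω)

lemma workFn_le (t : ℕ) (X : Fin k → Ω) (Y : ℕ → Fin k → Ω) (h0 : Y 0 = X₀)
    (hY : ∀ i ∈ Finset.Icc 1 t, ∃ j, Y i j = r i) :
    workFn k X₀ r t X ≤
      (∑ i ∈ Finset.Icc 1 t, confDist (Y (i - 1)) (Y i)) + confDist (Y t) X := by
  refine csInf_le ⟨0, ?_⟩ ⟨Y, h0, hY, rfl⟩
  rintro c ⟨Y, -, -, rfl⟩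
  exact add_nonneg (Finset.sum_nonneg fun _ _ => confDist_nonneg _ _) (confDist_nonneg _ _)

lemma le_workFn [NeZero k] (t : ℕ) (X : Fin k → Ω) (c : ℝ)
    (h : ∀ Y : ℕ → Fin k → Ω, Y 0 = X₀ → (∀ i ∈ Finset.Icc 1 t, ∃ j, Y i j = r i) →
      c ≤ (∑ i ∈ Finset.Icc 1 t, confDist (Y (i - 1)) (Y i)) + confDist (Y t) X) :
    c ≤ workFn k X₀ r t X := by
  refine le_csInf ⟨_, fun i => if i = 0 then X₀ else fun _ => r i, by simp, ?_, rfl⟩ ?_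
  · intro i hi
    have : i ≠ 0 := by have := (Finset.mem_Icc.1 hi).1; omega
    exact ⟨0, by simp [this]⟩
  · rintro _ ⟨Y, h0, hY, rfl⟩
    exact h Y h0 hY

lemma workFn_zero [NeZero k] (X : Fin k → Ω) : workFn k X₀ r 0 X = confDist X₀ X := by
  apply le_antisymm
  · simpa using workFn_le X₀ r 0 X (fun _ => X₀) rfl (by simp)
  · exact le_workFn X₀ r 0 X _ fun Y h0 _ => by simp [h0]

lemma workFn_comp_perm (t : ℕ) (X : Fin k → Ω) (σ : Equiv.Perm (Fin k)) :
    workFn k X₀ r t (X ∘ σ) = workFn k X₀ r t X := by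
  simp only [workFn, confDist_comp_perm]

lemma workFn_le_add_sum [NeZero k] (t : ℕ) (X Z : Fin k → Ω) :
    workFn k X₀ r t X ≤ workFn k X₀ r t Z + ∑ i, dist (Z i) (X i) := by
  rw [← sub_le_iff_le_add]
  refine le_workFn X₀ r t Z _ fun Y h0 hY => ?_
  linarith [workFn_le X₀ r t X Y h0 hY, confDist_le_add_sum (Y t) X Z]

lemma workFn_succ_le [NeZero k] (t : ℕ) (X Z : Fin k → Ω) (hZ : ∃ j, Z j = r (t + 1)) :
    workFn k X₀ r (t + 1) X ≤ workFn k X₀ r t Z + confDist Z X := by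
  rw [← sub_le_iff_le_add]
  refine le_workFn X₀ r t Z _ fun Y h0 hY => ?_
  have hlt : ∀ i ≤ t, Function.update Y (t + 1) Z i = Y i := fun i hi =>
    Function.update_of_ne (by omega) _ _
  have h := workFn_le X₀ r (t + 1) X (Function.update Y (t + 1) Z) (by simp [h0]) (by
    intro i hi
    rcases eq_or_ne i (t + 1) with rfl | hne
    · simpa using hZ
    · have := Finset.mem_Icc.1 hi
      rw [hlt i (by omega)]
      exact hY i (Finset.mem_Icc.2 (by omega)))
  rw [Finset.sum_Icc_succ_top (by omega)] at h
  have hs : ∑ i ∈ Finset.Icc 1 t, confDist (Function.update Y (t + 1) Z (i - 1))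
      (Function.update Y (t + 1) Z i) = ∑ i ∈ Finset.Icc 1 t, confDist (Y (i - 1)) (Y i) :=
    Finset.sum_congr rfl fun i hi => by
      have := Finset.mem_Icc.1 hi
      rw [hlt i (by omega), hlt (i - 1) (by omega)]
  rw [hs, Nat.add_sub_cancel, hlt t le_rfl] at h
  simp only [Function.update_self] at h
  linarith

lemma le_workFn_succ [NeZero k] (t : ℕ) (X : Fin k → Ω) (c : ℝ)
    (h : ∀ Z : Fin k → Ω, (∃ j, Z j = r (t + 1)) → c ≤ workFn k X₀ r t Z + confDist Z X) :
    c ≤ workFn k X₀ r (t + 1) X := by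
  refine le_workFn X₀ r (t + 1) X _ fun Y h0 hY => ?_
  have h1 := workFn_le X₀ r t (Y (t + 1)) Y h0 fun i hi =>
    hY i (Finset.Icc_subset_Icc_right (by omega) hi)
  have h2 := h (Y (t + 1)) (hY (t + 1) (by simp))
  rw [Finset.sum_Icc_succ_top (by omega), Nat.add_sub_cancel]
  linarith

lemma workFn_succ_le_update [NeZero k] (t : ℕ) (X : Fin k → Ω) (j : Fin k) :
    workFn k X₀ r (t + 1) X ≤
      workFn k X₀ r t (Function.update X j (r (t + 1))) + dist (X j) (r (t + 1)) := by
  refine (workFn_succ_le X₀ r t X (Function.update X j (r (t + 1)))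
    ⟨j, Function.update_self _ _ _⟩).trans ?_
  rw [← sum_dist_update_self X j (r (t + 1))]
  gcongr
  exact confDist_le_sum _ _ (Equiv.refl _)

/-- The work function recursion. -/
lemma exists_workFn_succ_eq [NeZero k] (t : ℕ) (X : Fin k → Ω) :
    ∃ j, workFn k X₀ r (t + 1) X =
      workFn k X₀ r t (Function.update X j (r (t + 1))) + dist (X j) (r (t + 1)) := by
  obtain ⟨j, hj⟩ := Finite.exists_min fun j =>
    workFn k X₀ r t (Function.update X j (r (t + 1))) + dist (X j) (r (t + 1))
  refine ⟨j, le_antisymm (workFn_succ_le_update X₀ r t X j) ?_⟩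
  refine le_workFn_succ X₀ r t X _ ?_
  rintro Z ⟨m, hm⟩
  obtain ⟨σ, hσ⟩ := exists_confDist_eq_sum Z X
  have h1 := hj (σ m)
  have h2 := workFn_le_add_sum X₀ r t (Function.update (X ∘ σ) m (r (t + 1))) Z
  have h3 := sum_dist_update_le Z (X ∘ σ) m _ hm
  have h4 : workFn k X₀ r t (Function.update X (σ m) (r (t + 1))) =
      workFn k X₀ r t (Function.update (X ∘ σ) m (r (t + 1))) := by
    rw [← workFn_comp_perm X₀ r t _ σ]
    congr 1
    rw [Function.update_comp_eq_of_injective _ σ.injective]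
  simp only [Function.comp_apply] at h1 h3
  linarith

lemma exists_update_add_dist_le_workFn_succ [NeZero k] (t : ℕ) (X : Fin k → Ω) :
    ∃ j, workFn k X₀ r (t + 1) (Function.update X j (r (t + 1))) + dist (X j) (r (t + 1)) ≤
      workFn k X₀ r (t + 1) X := by
  obtain ⟨j, hj⟩ := exists_workFn_succ_eq X₀ r t X
  refine ⟨j, ?_⟩
  have h := workFn_succ_le_update X₀ r t (Function.update X j (r (t + 1))) j
  simp only [Function.update_idem, Function.update_self, dist_self] at h
  linarith

/-- Work functions are quasi-convex. -/
lemma isQuasiconvexCost_workFn [NeZero k] (t : ℕ) :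
    IsQuasiconvexCost (workFn k X₀ r t) := by
  refine ⟨workFn_comp_perm X₀ r t, workFn_le_add_sum X₀ r t, ?_⟩
  induction t with
  | zero =>
    intro X Y
    simp only [workFn_zero]
    obtain ⟨σ, hσ⟩ := exists_confDist_eq_sum X₀ X
    obtain ⟨τ, hτ⟩ := exists_confDist_eq_sum X₀ Y
    refine ⟨σ.symm.trans τ, fun s => ?_⟩
    refine (add_le_add (confDist_le_sum _ _ σ) (confDist_le_sum _ _ σ)).trans_eq ?_
    rw [hσ, hτ, ← Finset.sum_add_distrib, ← Finset.sum_add_distrib]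
    refine Finset.sum_congr rfl fun i _ => ?_
    cases s (σ i) <;> simp [add_comm]
  | succ t ih =>
    intro X Y
    have hw : IsQuasiconvexCost (workFn k X₀ r t) :=
      ⟨workFn_comp_perm X₀ r t, workFn_le_add_sum X₀ r t, ih⟩
    obtain ⟨a, ha⟩ := exists_workFn_succ_eq X₀ r t X
    obtain ⟨b, hb⟩ := exists_workFn_succ_eq X₀ r t Y
    obtain ⟨σ, hab, hσ⟩ := hw.exchange_of_eq (Function.update X a (r (t + 1)))
      (Function.update Y b (r (t + 1))) a b (by simp)
    refine ⟨σ, fun s => ?_⟩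
    have hne : ∀ i, i ≠ a → σ i ≠ b := fun i hi h => hi (σ.injective (h.trans hab.symm))
    have h1 := workFn_succ_le_update X₀ r t (fun i => if s i then X i else Y (σ i)) a
    have h2 := workFn_succ_le_update X₀ r t (fun i => if s i then Y (σ i) else X i) a
    have e1 : Function.update (fun i => if s i then X i else Y (σ i)) a (r (t + 1)) =
        fun i => if s i then Function.update X a (r (t + 1)) i
          else Function.update Y b (r (t + 1)) (σ i) := by
      funext i
      rcases eq_or_ne i a with rfl | hi
      · simp [hab]
      · simp [hi, hne i hi]
    have e2 : Function.update (fun i => if s i then Y (σ i) else X i) a (r (t + 1)) =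
        fun i => if s i then Function.update Y b (r (t + 1)) (σ i)
          else Function.update X a (r (t + 1)) i := by
      funext i
      rcases eq_or_ne i a with rfl | hi
      · simp [hab]
      · simp [hi, hne i hi]
    rw [e1] at h1
    rw [e2] at h2
    have h3 := hσ s
    have h4 : dist (if s a then X a else Y (σ a)) (r (t + 1)) +
        dist (if s a then Y (σ a) else X a) (r (t + 1)) =
        dist (X a) (r (t + 1)) + dist (Y b) (r (t + 1)) := by
      rw [hab]
      cases s a <;> simp [add_comm]
    linarith

end WorkFunction

section ThreeServers

variable {Ω : Type*} [MetricSpace Ω] {w : (Fin 3 → Ω) → ℝ}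

lemma IsQuasiconvexCost.swap_right (hw : IsQuasiconvexCost w) (a p q : Ω) :
    w ![a, p, q] = w ![a, q, p] := by
  rw [← hw.comp_perm ![a, p, q] (Equiv.swap 1 2)]
  congr 1
  funext i
  fin_cases i <;> rfl

lemma IsQuasiconvexCost.swap_left (hw : IsQuasiconvexCost w) (a p q : Ω) :
    w ![a, p, q] = w ![p, a, q] := by
  rw [← hw.comp_perm ![a, p, q] (Equiv.swap 0 1)]
  congr 1
  funext i
  fin_cases i <;> rfl

lemma IsQuasiconvexCost.le_add_dist (hw : IsQuasiconvexCost w) (a b c a' b' c' : Ω) :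
    w ![a, b, c] ≤ w ![a', b', c'] + (dist a' a + dist b' b + dist c' c) := by
  simpa [Fin.sum_univ_three] using hw.le_add_sum ![a, b, c] ![a', b', c']

/-- With one server pinned, quasi-convexity becomes a four-point condition. -/
lemma IsQuasiconvexCost.four_point (hw : IsQuasiconvexCost w) (a p q s t : Ω) :
    w ![a, p, s] + w ![a, q, t] ≤ w ![a, p, q] + w ![a, s, t] ∨
      w ![a, p, t] + w ![a, q, s] ≤ w ![a, p, q] + w ![a, s, t] := by
  obtain ⟨σ, h0, hσ⟩ := hw.exchange_of_eq ![a, p, q] ![a, s, t] 0 0 rfl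
  have h := hσ ![true, true, false]
  have e1 : (fun i => if (![true, true, false] : Fin 3 → Bool) i then ![a, p, q] i
      else ![a, s, t] (σ i)) = ![a, p, ![a, s, t] (σ 2)] := by
    funext i; fin_cases i <;> rfl
  have e2 : (fun i => if (![true, true, false] : Fin 3 → Bool) i then ![a, s, t] (σ i)
      else ![a, p, q] i) = ![a, ![a, s, t] (σ 1), q] := by
    funext i; fin_cases i <;> simp [h0]
  rw [e1, e2, hw.swap_right _ _ q] at h
  have h12 : (σ 1 = 1 ∧ σ 2 = 2) ∨ (σ 1 = 2 ∧ σ 2 = 1) := by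
    have n1 : σ 1 ≠ σ 0 := σ.injective.ne (by decide)
    have n2 : σ 2 ≠ σ 0 := σ.injective.ne (by decide)
    have n3 : σ 1 ≠ σ 2 := σ.injective.ne (by decide)
    rw [h0] at n1 n2
    omega
  rcases h12 with ⟨g1, g2⟩ | ⟨g1, g2⟩ <;> rw [g1, g2] at h
  · exact Or.inr h
  · exact Or.inl h

lemma IsQuasiconvexCost.four_point_self (hw : IsQuasiconvexCost w) (a p s t : Ω) :
    w ![a, p, s] + w ![a, p, t] ≤ w ![a, p, p] + w ![a, s, t] := by
  rcases hw.four_point a p p s t with h | h <;> linarith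

end ThreeServers

section Circle

variable {Δ : ℝ}

lemma norm_coe_eq_of_abs_le (hΔ : 0 < Δ) (s : ℝ) (h : |s| ≤ Δ) :
    ‖(s : AddCircle (2 * Δ))‖ = |s| := by
  refine (AddCircle.norm_coe_eq_abs_iff _ (by linarith)).2 ?_
  rw [abs_of_pos (by linarith : (0 : ℝ) < 2 * Δ)]
  linarith

lemma exists_abs_le_coe_eq (hΔ : 0 < Δ) (x : AddCircle (2 * Δ)) :
    ∃ s : ℝ, |s| ≤ Δ ∧ (s : AddCircle (2 * Δ)) = x ∧ ‖x‖ = |s| := by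
  have : Fact (0 < 2 * Δ) := ⟨by linarith⟩
  obtain ⟨s, hs, rfl⟩ := (AddCircle.coe_image_Ico_eq (2 * Δ) (-Δ)).symm ▸ Set.mem_univ x
  have h : |s| ≤ Δ := abs_le.2 ⟨hs.1, by linarith [hs.2]⟩
  exact ⟨s, h, rfl, norm_coe_eq_of_abs_le hΔ s h⟩

lemma norm_coe_eq_of_le_abs (hΔ : 0 < Δ) (s : ℝ) (h1 : Δ ≤ |s|) (h2 : |s| ≤ 2 * Δ) :
    ‖(s : AddCircle (2 * Δ))‖ = 2 * Δ - |s| := by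
  rcases abs_cases s with ⟨hs, h0⟩ | ⟨hs, h0⟩ <;> rw [hs] at h1 h2 ⊢
  · rw [show s = s - 2 * Δ + 2 * Δ by ring, AddCircle.coe_add_period,
      norm_coe_eq_of_abs_le hΔ _ (abs_le.2 ⟨by linarith, by linarith⟩), abs_of_nonpos (by linarith)]
    ring
  · rw [← AddCircle.coe_add_period,
      norm_coe_eq_of_abs_le hΔ _ (abs_le.2 ⟨by linarith, by linarith⟩), abs_of_nonneg (by linarith)]
    ring

/-- Three points of a circle either lie on a geodesic or are on no open semicircle. -/
lemma dist_trichotomy (hΔ : 0 < Δ) (a b c : AddCircle (2 * Δ)) :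
    dist a b + dist b c = dist a c ∨ dist b a + dist a c = dist b c ∨
      dist a c + dist c b = dist a b ∨ dist a b + dist b c + dist c a = 2 * Δ := by
  obtain ⟨s, hs, es, ns⟩ := exists_abs_le_coe_eq hΔ (a - b)
  obtain ⟨t, ht, et, nt⟩ := exists_abs_le_coe_eq hΔ (b - c)
  have hac : a - c = ((s + t : ℝ) : AddCircle (2 * Δ)) := by
    rw [AddCircle.coe_add, es, et]
    abel
  rw [dist_comm b a, dist_comm c b, dist_comm c a, dist_eq_norm a b, dist_eq_norm b c,
    dist_eq_norm a c, ns, nt, hac]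
  rcases le_total |s + t| Δ with h | h
  · rw [norm_coe_eq_of_abs_le hΔ _ h]
    grind
  · rw [norm_coe_eq_of_le_abs hΔ _ h ((abs_add_le s t).trans (by linarith))]
    grind

lemma dist_antip_right (hΔ : 0 < Δ) (x y : AddCircle (2 * Δ)) :
    dist x (antip Δ y) = Δ - dist x y := by
  obtain ⟨s, hs, es, ns⟩ := exists_abs_le_coe_eq hΔ (x - y)
  have h : x - antip Δ y = ((s - Δ : ℝ) : AddCircle (2 * Δ)) := by
    rw [antip, AddCircle.coe_sub, es]
    abel
  rw [dist_eq_norm, dist_eq_norm x y, ns, h]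
  obtain ⟨h1, h2⟩ := abs_le.1 hs
  rcases le_total 0 s with h0 | h0
  · rw [norm_coe_eq_of_abs_le hΔ _ (abs_le.2 ⟨by linarith, by linarith⟩), abs_of_nonneg h0,
      abs_of_nonpos (by linarith)]
    ring
  · rw [norm_coe_eq_of_le_abs hΔ, abs_of_nonpos h0, abs_of_nonpos (by linarith)]
    · ring
    · rw [abs_of_nonpos (by linarith)]; linarith
    · rw [abs_of_nonpos (by linarith)]; linarith

lemma dist_antip_left (hΔ : 0 < Δ) (x y : AddCircle (2 * Δ)) :
    dist (antip Δ x) y = Δ - dist x y := by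
  rw [dist_comm, dist_antip_right hΔ, dist_comm]

lemma antip_antip (x : AddCircle (2 * Δ)) : antip Δ (antip Δ x) = x := by
  rw [antip, antip, add_assoc, ← AddCircle.coe_add, ← two_mul, AddCircle.coe_period, add_zero]

end Circle

lemma update_vec3_zero {α : Type*} (a b c p : α) :
    Function.update ![a, b, c] 0 p = ![p, b, c] := by
  funext i
  fin_cases i <;> rfl

lemma update_vec3_one {α : Type*} (a b c p : α) :
    Function.update ![a, b, c] 1 p = ![a, p, c] := by
  funext i
  fin_cases i <;> rfl

lemma update_vec3_two {α : Type*} (a b c p : α) :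
    Function.update ![a, b, c] 2 p = ![a, b, p] := by
  funext i
  fin_cases i <;> rfl

section Potential

variable {Δ : ℝ} {w : (Fin 3 → AddCircle (2 * Δ)) → ℝ}

/-- The case analysis of `phiStar_subcase_2b` for an arbitrary quasi-convex cost, according to
the position of `u` relative to the antipodes of `x` and `z`. -/
lemma IsQuasiconvexCost.exists_phiStar_le (hΔ : 0 < Δ) (hw : IsQuasiconvexCost w)
    (ρ u x y z : AddCircle (2 * Δ))
    (h1 : ResolvesFrom w ρ ![u, x, antip Δ y] 0)
    (h2 : ResolvesFrom w ρ ![u, y, antip Δ z] 1)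
    (h3 : ResolvesFrom w ρ ![u, z, antip Δ x] 0)
    (hu : ∃ j, w (Function.update ![antip Δ u, antip Δ u, antip Δ u] j ρ)
      + dist (![antip Δ u, antip Δ u, antip Δ u] j) ρ
        ≤ w ![antip Δ u, antip Δ u, antip Δ u])
    (harc : dist (antip Δ y) ρ + dist ρ (antip Δ z) = dist (antip Δ y) (antip Δ z)) :
    ∃ x' y' z' : AddCircle (2 * Δ), InP Δ x' y' z' ∧
      PhiStar Δ w ρ x' y' z' ≤ PhiStar Δ w u x y z := by
  have h1' : w ![u, x, antip Δ y] = w ![ρ, x, antip Δ y] + dist u ρ := by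
    simpa [ResolvesFrom, update_vec3_zero] using h1
  have h2' : w ![u, y, antip Δ z] = w ![ρ, u, antip Δ z] + dist y ρ := by
    rw [hw.swap_left ρ]
    simpa [ResolvesFrom, update_vec3_one] using h2
  have h3' : w ![u, z, antip Δ x] = w ![ρ, z, antip Δ x] + dist u ρ := by
    simpa [ResolvesFrom, update_vec3_zero] using h3
  have hu' : w ![ρ, antip Δ u, antip Δ u] + (Δ - dist u ρ)
      ≤ w ![antip Δ u, antip Δ u, antip Δ u] := by
    rw [← dist_antip_left hΔ]
    obtain ⟨j, hj⟩ := hu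
    fin_cases j
    · simpa [update_vec3_zero] using hj
    · rw [hw.swap_left]
      simpa [update_vec3_one] using hj
    · rw [hw.swap_left, hw.swap_right]
      simpa [update_vec3_two] using hj
  have hR : ∀ p q, w ![antip Δ ρ, antip Δ ρ, antip Δ ρ]
      ≤ w ![ρ, p, q] + (Δ + (Δ - dist p ρ) + (Δ - dist q ρ)) := fun p q => by
    have h := hw.le_add_dist (antip Δ ρ) (antip Δ ρ) (antip Δ ρ) ρ p q
    simpa only [dist_antip_right hΔ, dist_self, sub_zero] using h
  have hRy := hR (antip Δ u) (antip Δ y)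
  have hRz := hR (antip Δ u) z
  simp only [dist_antip_left hΔ, dist_antip_right hΔ] at harc hRy hRz
  have c1 := dist_comm ρ z
  have c2 := dist_comm x u
  have c3 := dist_comm x z
  have c4 := dist_comm u z
  rcases dist_trichotomy hΔ (antip Δ x) u (antip Δ z) with h | h | h | h <;>
    simp only [dist_antip_left hΔ, dist_antip_right hΔ] at h
  · refine ⟨x, u, z, ?_, ?_⟩
    · simp only [InP]; linarith
    have q1 := hw.four_point_self ρ (antip Δ u) x (antip Δ y)
    rw [hw.swap_right ρ _ x] at q1
    simp only [PhiStar]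
    linarith
  · simp only [PhiStar]
    have s1 := hw.swap_right ρ (antip Δ u) x
    have s2 := hw.swap_right ρ (antip Δ z) u
    have s3 := hw.swap_right ρ (antip Δ y) x
    rcases hw.four_point ρ z (antip Δ x) (antip Δ z) u with q | q
    · refine ⟨antip Δ u, z, antip Δ x, ?_, ?_⟩
      · simp only [InP, dist_antip_left hΔ, dist_antip_right hΔ]; linarith
      have q1 := hw.four_point_self ρ (antip Δ u) z (antip Δ z)
      have q2 := hw.le_add_dist ρ z x ρ (antip Δ y) x
      simp only [dist_self, dist_antip_left hΔ] at q2
      simp only [antip_antip]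
      linarith
    · refine ⟨antip Δ u, antip Δ x, z, ?_, ?_⟩
      · simp only [InP, dist_antip_left hΔ, dist_antip_right hΔ]; linarith
      have q1 := hw.four_point_self ρ (antip Δ u) x (antip Δ y)
      simp only [antip_antip]
      linarith
  · simp only [PhiStar]
    have s1 := hw.swap_right ρ (antip Δ x) (antip Δ u)
    have s2 := hw.swap_right ρ (antip Δ y) x
    refine ⟨u, z, antip Δ x, ?_, ?_⟩
    · simp only [InP, dist_antip_left hΔ, dist_antip_right hΔ]; linarith
    have q1 := hw.four_point_self ρ (antip Δ u) z (antip Δ x)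
    have q2 := hw.le_add_dist ρ z x ρ (antip Δ y) x
    simp only [dist_self, dist_antip_left hΔ] at q2
    simp only [antip_antip]
    linarith
  · simp only [PhiStar]
    have s1 := hw.swap_right ρ z (antip Δ x)
    have s2 := hw.swap_right ρ (antip Δ u) (antip Δ z)
    have s3 := hw.swap_right ρ x u
    have s4 := hw.swap_right ρ x (antip Δ z)
    have s5 := hw.swap_right ρ (antip Δ y) u
    have s6 := hw.swap_right ρ (antip Δ u) (antip Δ x)
    rcases hw.four_point ρ x (antip Δ y) u (antip Δ z) with q | q
    · refine ⟨antip Δ x, antip Δ z, u, ?_, ?_⟩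
      · simp only [InP, dist_antip_left hΔ, dist_antip_right hΔ]; linarith
      have q1 := hw.four_point_self ρ (antip Δ u) (antip Δ y) (antip Δ z)
      simp only [antip_antip]
      linarith
    · refine ⟨antip Δ z, antip Δ x, u, ?_, ?_⟩
      · simp only [InP, dist_antip_left hΔ, dist_antip_right hΔ]; linarith
      have q1 := hw.four_point_self ρ (antip Δ u) z (antip Δ x)
      have q2 := hw.le_add_dist ρ u z ρ u (antip Δ y)
      simp only [dist_self, dist_antip_left hΔ] at q2
      simp only [antip_antip]
      linarith

end Potential

/-- Subcase 2b: if both `w(u x ȳ)` and `w(u z x̄)` resolve from `u`, `w(u y z̄)` resolves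
from `y`, and `r` lies on the arc between `ȳ` and `z̄` not containing `x̄`, then there is
`(x',y',z') ∈ P` with `Φ*(w,u,x,y,z) ≥ Φ*(w,r,x',y',z')`. -/
theorem phiStar_subcase_2b (Δ : ℝ) (hΔ : 0 < Δ)
    (X₀ : Fin 3 → AddCircle (2*Δ)) (r : ℕ → AddCircle (2*Δ)) (T t : ℕ)
    (ht : 1 ≤ t) (htT : t ≤ T) (u x y z : AddCircle (2*Δ)) (hP : InP Δ x y z)
    (h1 : ResolvesFrom (workFn 3 X₀ r t) (r t) ![u, x, antip Δ y] 0)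
    (h2 : ResolvesFrom (workFn 3 X₀ r t) (r t) ![u, y, antip Δ z] 1)
    (h3 : ResolvesFrom (workFn 3 X₀ r t) (r t) ![u, z, antip Δ x] 0)
    (harc : dist (antip Δ y) (r t) + dist (r t) (antip Δ z) =
      dist (antip Δ y) (antip Δ z)) :
    ∃ x' y' z' : AddCircle (2*Δ), InP Δ x' y' z' ∧
      PhiStar Δ (workFn 3 X₀ r t) (r t) x' y' z' ≤
        PhiStar Δ (workFn 3 X₀ r t) u x y z := by
  obtain ⟨t, rfl⟩ := Nat.exists_eq_succ_of_ne_zero (Nat.one_le_iff_ne_zero.1 ht)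
  exact (isQuasiconvexCost_workFn X₀ r (t + 1)).exists_phiStar_le hΔ (r (t + 1)) u x y z h1 h2 h3
    (exists_update_add_dist_le_workFn_succ X₀ r t _) harc
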